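/- arXiv:1706.00098 — 5 statements merged into one kernel-verified Lean document; each statement's English description precedes it below -/
import Mathlib

section
/- If (γ̂, α̂) ∈ {0,1}^p × ℝ^p is a global minimizer of the variable-selection objective G, then α̂ᵢ ≠ 0 for every i with γ̂ᵢ = 1, and β̂ := γ̂∘α̂ is a global minimizer of the l0-regularized least squares objective F with F(β̂) = G(γ̂, α̂). -/
open scoped BigOperators

/-- `l0norm β` is the number of nonzero entries of `β`. -/
noncomputable def l0norm {p : ℕ} (β : Fin p → ℝ) : ℕ :=
  (Finset.univ.filter fun i => β i ≠ 0).card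

/-- If `(γ̂, α̂)` is a global minimizer of the variable-selection objective
`G(γ, α) = ½‖y − X(γ∘α)‖₂² + λ‖γ‖₀`, then `α̂ᵢ ≠ 0` whenever `γ̂ᵢ = 1`, and
`β̂ := γ̂∘α̂` is a global minimizer of the `l0`-regularized least squares objective
`F(β) = ½‖y − Xβ‖₂² + λ‖β‖₀`, with `F(β̂) = G(γ̂, α̂)`. -/
theorem varsel_minimizer_gives_l0_minimizer (n p : ℕ) (y : Fin n → ℝ)
    (X : Matrix (Fin n) (Fin p) ℝ) (lam : ℝ) (hlam : 0 < lam)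
    (F : (Fin p → ℝ) → ℝ)
    (hF : ∀ β, F β = (1 / 2) * ∑ i, (y i - X.mulVec β i) ^ 2 + lam * (l0norm β : ℝ))
    (G : (Fin p → Bool) → (Fin p → ℝ) → ℝ)
    (hG : ∀ γ α, G γ α =
      (1 / 2) * ∑ i, (y i - X.mulVec (fun j => if γ j then α j else 0) i) ^ 2
        + lam * ((Finset.univ.filter fun i => γ i = true).card : ℝ))
    (γhat : Fin p → Bool) (αhat : Fin p → ℝ)
    (hmin : ∀ (γ : Fin p → Bool) (α : Fin p → ℝ), G γhat αhat ≤ G γ α)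
    (βhat : Fin p → ℝ) (hβhat : ∀ i, βhat i = if γhat i then αhat i else 0) :
    (∀ i, γhat i = true → αhat i ≠ 0) ∧
      (∀ β : Fin p → ℝ, F βhat ≤ F β) ∧ F βhat = G γhat αhat := by
  have hsupp : ∀ β, F β = G (fun i => decide (β i ≠ 0)) β := by
    intro β
    have hβ : (fun j => if decide (β j ≠ 0) = true then β j else 0) = β := by
      funext j
      by_cases h : β j = 0 <;> simp [h]
    rw [hF, hG, hβ]
    simp [l0norm]
  have hβ : (fun j => if γhat j then αhat j else 0) = βhat := funext fun j => (hβhat j).symm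
  have hle : ∀ β, G γhat αhat ≤ F β := fun β => (hmin _ β).trans_eq (hsupp β).symm
  have hsub : (Finset.univ.filter fun i => βhat i ≠ 0) ⊆
      Finset.univ.filter fun i => γhat i = true := by
    intro i hi
    simp only [Finset.mem_filter, Finset.mem_univ, true_and] at hi ⊢
    by_contra h
    exact hi (by rw [hβhat, if_neg h])
  have hcard : (Finset.univ.filter fun i => γhat i = true).card ≤ l0norm βhat := by
    have h := hle βhat
    rw [hG, hF, hβ, add_le_add_iff_left, mul_le_mul_iff_right₀ hlam] at h
    exact_mod_cast h
  have heq := Finset.eq_of_subset_of_card_le hsub hcard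
  have hFG : F βhat = G γhat αhat := by
    rw [hF, hG, hβ, l0norm, heq]
  refine ⟨fun i hi hα => ?_, fun β => hFG ▸ hle β, hFG⟩
  have hmem : i ∈ Finset.univ.filter fun i => βhat i ≠ 0 := by
    rw [heq]
    simpa using hi
  exact (Finset.mem_filter.mp hmem).2 (by simp [hβhat, hα])
end

section
/- (Tweedie's formula.) Let σ > 0 and let μ be any probability measure on ℝ, with marginal density m(y) = ∫ φ_σ(y − β) dμ(β). Then m(y) > 0 for every y, the function β ↦ β φ_σ(y − β) is μ-integrable, and the posterior mean satisfies (1/m(y)) ∫ β φ_σ(y − β) dμ(β) = y + σ² m′(y)/m(y), i.e., E[β | y] = y + σ² (d/dy) log m(y). -/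
open MeasureTheory Real

/-- The density of the normal distribution `N(0, σ²)` at `t`. -/
noncomputable def gaussPdf (σ t : ℝ) : ℝ :=
  (Real.sqrt (2 * Real.pi * σ ^ 2))⁻¹ * Real.exp (-(t ^ 2) / (2 * σ ^ 2))

theorem gaussPdf_pos {σ : ℝ} (hσ : 0 < σ) (t : ℝ) : 0 < gaussPdf σ t := by
  unfold gaussPdf
  positivity

theorem continuous_gaussPdf (σ : ℝ) : Continuous (gaussPdf σ) := by
  unfold gaussPdf
  fun_prop

theorem gaussPdf_le (σ t : ℝ) : gaussPdf σ t ≤ (√(2 * π * σ ^ 2))⁻¹ := by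
  have h : -(t ^ 2) / (2 * σ ^ 2) ≤ 0 :=
    div_nonpos_of_nonpos_of_nonneg (by nlinarith) (by positivity)
  exact mul_le_of_le_one_right (by positivity) (exp_le_one_iff.2 h)

theorem abs_mul_gaussPdf_le {σ : ℝ} (hσ : 0 < σ) (t : ℝ) :
    |t| * gaussPdf σ t ≤ σ * (√(2 * π * σ ^ 2))⁻¹ := by
  have h : |t| * exp (-(t ^ 2) / (2 * σ ^ 2)) ≤ σ := by
    rw [neg_div, exp_neg, ← div_eq_mul_inv, div_le_iff₀ (exp_pos _)]
    calc |t| ≤ σ * (t ^ 2 / (2 * σ ^ 2) + 1) := by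
          have : σ * (t ^ 2 / (2 * σ ^ 2) + 1) - |t| = ((|t| - σ) ^ 2 + σ ^ 2) / (2 * σ) := by
            rw [← sq_abs t]
            field_simp
            ring
          have : 0 ≤ ((|t| - σ) ^ 2 + σ ^ 2) / (2 * σ) := by positivity
          linarith
      _ ≤ σ * exp (t ^ 2 / (2 * σ ^ 2)) := by
          gcongr
          exact add_one_le_exp _
  calc |t| * gaussPdf σ t
      = (|t| * exp (-(t ^ 2) / (2 * σ ^ 2))) * (√(2 * π * σ ^ 2))⁻¹ := by
        unfold gaussPdf
        ring
    _ ≤ σ * (√(2 * π * σ ^ 2))⁻¹ := by gcongr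

theorem hasDerivAt_gaussPdf (σ t : ℝ) :
    HasDerivAt (gaussPdf σ) (-(t / σ ^ 2) * gaussPdf σ t) t := by
  have h := ((((hasDerivAt_id t).pow 2).neg.div_const (2 * σ ^ 2)).exp).const_mul
    (√(2 * π * σ ^ 2))⁻¹
  refine h.congr_deriv ?_
  simp [gaussPdf]
  ring

theorem integrable_gaussPdf_sub {σ : ℝ} (hσ : 0 < σ) (μ : Measure ℝ) [IsFiniteMeasure μ] (y : ℝ) :
    Integrable (fun β => gaussPdf σ (y - β)) μ := by
  refine Integrable.of_bound
    ((continuous_gaussPdf σ).comp (continuous_const.sub continuous_id)).aestronglyMeasurable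
    (√(2 * π * σ ^ 2))⁻¹ (ae_of_all _ fun β => ?_)
  rw [norm_of_nonneg (gaussPdf_pos hσ _).le]
  exact gaussPdf_le σ _

theorem integral_gaussPdf_sub_pos {σ : ℝ} (hσ : 0 < σ) (μ : Measure ℝ) [IsFiniteMeasure μ]
    [NeZero μ] (y : ℝ) : 0 < ∫ β, gaussPdf σ (y - β) ∂μ := by
  rw [integral_pos_iff_support_of_nonneg (fun β => (gaussPdf_pos hσ _).le)
    (integrable_gaussPdf_sub hσ μ y)]
  have : Function.support (fun β => gaussPdf σ (y - β)) = Set.univ :=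
    Set.eq_univ_of_forall fun β => (gaussPdf_pos hσ _).ne'
  rw [this]
  exact NeZero.pos (μ Set.univ)

theorem hasDerivAt_integral_gaussPdf_sub {σ : ℝ} (hσ : 0 < σ) (μ : Measure ℝ) [IsFiniteMeasure μ]
    (y : ℝ) :
    Integrable (fun β => -((y - β) / σ ^ 2) * gaussPdf σ (y - β)) μ ∧
      HasDerivAt (fun t => ∫ β, gaussPdf σ (t - β) ∂μ)
        (∫ β, -((y - β) / σ ^ 2) * gaussPdf σ (y - β) ∂μ) y := by
  have hc := continuous_gaussPdf σ
  refine hasDerivAt_integral_of_dominated_loc_of_deriv_le (s := Set.univ)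
    (F := fun t β => gaussPdf σ (t - β))
    (F' := fun t β => -((t - β) / σ ^ 2) * gaussPdf σ (t - β))
    (bound := fun _ => σ * (√(2 * π * σ ^ 2))⁻¹ / σ ^ 2) Filter.univ_mem
    (Filter.Eventually.of_forall fun t =>
      (hc.comp (continuous_const.sub continuous_id)).aestronglyMeasurable)
    (integrable_gaussPdf_sub hσ μ y) ?_ (ae_of_all _ fun β t _ => ?_)
    (integrable_const _) (ae_of_all _ fun β t _ => ?_)
  · exact Continuous.aestronglyMeasurable (by fun_prop)
  · rw [norm_mul, norm_neg, norm_div, norm_of_nonneg (gaussPdf_pos hσ _).le,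
      norm_of_nonneg (sq_nonneg σ), norm_eq_abs, div_mul_eq_mul_div]
    exact div_le_div_of_nonneg_right (abs_mul_gaussPdf_le hσ _) (sq_nonneg σ)
  · exact (hasDerivAt_gaussPdf σ (t - β)).comp_sub_const t β

/-- Tweedie's formula: for the normal means model `y | β ∼ N(β, σ²)` with prior `μ`,
the marginal density `m(y) = ∫ φ_σ(y − β) dμ(β)` is positive, `β ↦ β φ_σ(y − β)` is
`μ`-integrable, and the posterior mean satisfies
`E[β | y] = y + σ² m′(y)/m(y) = y + σ² (d/dy) log m(y)`. -/
theorem tweedie_formula (σ : ℝ) (hσ : 0 < σ)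
    (μ : Measure ℝ) [IsProbabilityMeasure μ]
    (m : ℝ → ℝ) (hm : ∀ t, m t = ∫ β, gaussPdf σ (t - β) ∂μ) (y : ℝ) :
    0 < m y ∧
      Integrable (fun β => β * gaussPdf σ (y - β)) μ ∧
      (m y)⁻¹ * ∫ β, β * gaussPdf σ (y - β) ∂μ
        = y + σ ^ 2 * (deriv m y / m y) ∧
      (m y)⁻¹ * ∫ β, β * gaussPdf σ (y - β) ∂μ
        = y + σ ^ 2 * deriv (fun t => Real.log (m t)) y := by
  obtain rfl : m = fun t => ∫ β, gaussPdf σ (t - β) ∂μ := funext hm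
  have hpos := integral_gaussPdf_sub_pos hσ μ y
  obtain ⟨hint', hderiv⟩ := hasDerivAt_integral_gaussPdf_sub hσ μ y
  have hint := integrable_gaussPdf_sub hσ μ y
  have hsplit : (fun β => β * gaussPdf σ (y - β)) = fun β =>
      y * gaussPdf σ (y - β) + σ ^ 2 * (-((y - β) / σ ^ 2) * gaussPdf σ (y - β)) := by
    funext β
    field_simp
    ring
  have hmean : (∫ β, gaussPdf σ (y - β) ∂μ)⁻¹ * ∫ β, β * gaussPdf σ (y - β) ∂μ
      = y + σ ^ 2 * ((∫ β, -((y - β) / σ ^ 2) * gaussPdf σ (y - β) ∂μ) /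
        ∫ β, gaussPdf σ (y - β) ∂μ) := by
    rw [hsplit, integral_add (hint.const_mul y) (hint'.const_mul (σ ^ 2)),
      integral_const_mul, integral_const_mul]
    field_simp [hpos.ne']
  refine ⟨hpos, ?_, ?_, ?_⟩
  · rw [hsplit]
    exact (hint.const_mul y).add (hint'.const_mul (σ ^ 2))
  · rw [hderiv.deriv]
    exact hmean
  · rw [(hderiv.log hpos.ne').deriv]
    exact hmean
end

section
/- (Gradient of the Moreau envelope.) Let E be a real Hilbert space, f : E → ℝ convex, γ > 0, and suppose p : E → E is such that for every x ∈ E, p(x) is the unique minimizer over z ∈ E of f(z) + ‖z − x‖²/(2γ). Then the Moreau envelope E_{γf}(x) = f(p(x)) + ‖p(x) − x‖²/(2γ) is Fréchet differentiable at every x ∈ E with gradient ∇E_{γf}(x) = (x − p(x))/γ; equivalently, prox_{γf}(x) = x − γ ∇E_{γf}(x). -/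
open Filter Topology Asymptotics

/-- If `p` minimizes `z ↦ f z + ‖z - x‖ ^ 2 / (2 * γ)` with `f` convex, then `γ⁻¹ • (x - p)` is a
subgradient of `f` at `p`. -/
theorem ConvexOn.prox_subgradient {E : Type*} [NormedAddCommGroup E] [InnerProductSpace ℝ E]
    {f : E → ℝ} (hf : ConvexOn ℝ Set.univ f) {γ : ℝ} (hγ : 0 < γ) {x p : E}
    (hmin : ∀ z, f p + ‖p - x‖ ^ 2 / (2 * γ) ≤ f z + ‖z - x‖ ^ 2 / (2 * γ)) (z : E) :
    f p + inner ℝ (x - p) (z - p) / γ ≤ f z := by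
  have key : ∀ᶠ t : ℝ in 𝓝[>] 0,
      0 ≤ f z - f p - inner ℝ (x - p) (z - p) / γ + t * (‖z - p‖ ^ 2 / (2 * γ)) := by
    filter_upwards [Ioc_mem_nhdsGT (zero_lt_one' ℝ)] with t ⟨ht0, ht1⟩
    have hconv := hf.2 (Set.mem_univ p) (Set.mem_univ z) (sub_nonneg.2 ht1) ht0.le
      (sub_add_cancel 1 t)
    have hm := hmin ((1 - t) • p + t • z)
    have hnorm : ‖(1 - t) • p + t • z - x‖ ^ 2
        = ‖p - x‖ ^ 2 - 2 * t * inner ℝ (x - p) (z - p) + t ^ 2 * ‖z - p‖ ^ 2 := by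
      have hvec : (1 - t) • p + t • z - x = t • (z - p) - (x - p) := by module
      rw [hvec, norm_sub_sq_real, norm_smul, mul_pow, Real.norm_eq_abs, sq_abs,
        real_inner_smul_left, real_inner_comm, norm_sub_rev x p]
      ring
    rw [hnorm] at hm
    simp only [smul_eq_mul] at hconv
    refine nonneg_of_mul_nonneg_right (a := t) ?_ ht0
    have hexp : (‖p - x‖ ^ 2 - 2 * t * inner ℝ (x - p) (z - p) + t ^ 2 * ‖z - p‖ ^ 2) / (2 * γ)
        = ‖p - x‖ ^ 2 / (2 * γ) - t * (inner ℝ (x - p) (z - p) / γ)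
          + t * (t * (‖z - p‖ ^ 2 / (2 * γ))) := by
      field_simp
    rw [hexp] at hm
    linarith
  have hlim : Tendsto (fun t : ℝ ↦ f z - f p - inner ℝ (x - p) (z - p) / γ
      + t * (‖z - p‖ ^ 2 / (2 * γ))) (𝓝[>] 0) (𝓝 (f z - f p - inner ℝ (x - p) (z - p) / γ)) := by
    refine Tendsto.mono_left ?_ nhdsWithin_le_nhds
    refine Continuous.tendsto' (by fun_prop) _ _ (by simp)
  linarith [ge_of_tendsto hlim key]

/-- A function with a quadratic first-order error bound has the corresponding gradient. -/
theorem HasGradientAt.of_abs_sub_le_mul_sq {E : Type*} [NormedAddCommGroup E]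
    [InnerProductSpace ℝ E] [CompleteSpace E] {g : E → ℝ} {v x : E} (C : ℝ)
    (h : ∀ y, |g y - g x - inner ℝ v (y - x)| ≤ C * ‖y - x‖ ^ 2) : HasGradientAt g v x := by
  rw [hasGradientAt_iff_isLittleO]
  have hO : (fun y ↦ g y - g x - inner ℝ v (y - x)) =O[𝓝 x] fun y ↦ ‖y - x‖ ^ 2 :=
    IsBigO.of_bound C (Eventually.of_forall fun y ↦ by simpa using h y)
  exact hO.trans_isLittleO (isLittleO_pow_sub_sub x one_lt_two)


/-- Gradient of the Moreau envelope: on a real Hilbert space, if `f` is convex and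
`p x` is for each `x` the unique minimizer of `z ↦ f(z) + ‖z − x‖²/(2γ)`, then the
Moreau envelope `E_{γf}(x) = f(p(x)) + ‖p(x) − x‖²/(2γ)` is differentiable with
gradient `∇E_{γf}(x) = (x − p(x))/γ`; equivalently `prox_{γf}(x) = x − γ ∇E_{γf}(x)`. -/
theorem moreau_envelope_gradient {E : Type*} [NormedAddCommGroup E]
    [InnerProductSpace ℝ E] [CompleteSpace E]
    (f : E → ℝ) (hf : ConvexOn ℝ Set.univ f) (γ : ℝ) (hγ : 0 < γ)
    (p : E → E)
    (hmin : ∀ x z : E,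
      f (p x) + ‖p x - x‖ ^ 2 / (2 * γ) ≤ f z + ‖z - x‖ ^ 2 / (2 * γ))
    (huniq : ∀ x z : E,
      (∀ w : E, f z + ‖z - x‖ ^ 2 / (2 * γ) ≤ f w + ‖w - x‖ ^ 2 / (2 * γ)) → z = p x)
    (env : E → ℝ) (henv : ∀ x, env x = f (p x) + ‖p x - x‖ ^ 2 / (2 * γ)) :
    ∀ x : E, HasGradientAt env (γ⁻¹ • (x - p x)) x ∧
      p x = x - γ • (γ⁻¹ • (x - p x)) := by
  intro x
  refine ⟨.of_abs_sub_le_mul_sq (1 / (2 * γ)) fun y ↦ ?_, ?_⟩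
  · have hsub := hf.prox_subgradient hγ (hmin x) (p y)
    have hupper := hmin y (p x)
    have hgap : ‖p y - y‖ ^ 2 / (2 * γ) + inner ℝ (x - p x) (p y - p x) / γ
        - ‖p x - x‖ ^ 2 / (2 * γ) - γ⁻¹ * inner ℝ (x - p x) (y - x)
        = ‖(x - p x) - (y - p y)‖ ^ 2 / (2 * γ) := by
      have hvec : p y - p x = (x - p x) - (y - p y) + (y - x) := by abel
      rw [hvec, inner_add_right, inner_sub_right, real_inner_self_eq_norm_sq,
        norm_sub_sq_real (x - p x), norm_sub_rev (p y), norm_sub_rev (p x)]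
      field_simp
      ring
    have hshift : ‖p x - y‖ ^ 2 / (2 * γ) = ‖p x - x‖ ^ 2 / (2 * γ)
        + γ⁻¹ * inner ℝ (x - p x) (y - x) + 1 / (2 * γ) * ‖y - x‖ ^ 2 := by
      have hvec : y - p x = (x - p x) + (y - x) := by abel
      rw [norm_sub_rev, hvec, norm_add_sq_real, norm_sub_rev (p x)]
      field_simp
    have hnonneg : 0 ≤ ‖(x - p x) - (y - p y)‖ ^ 2 / (2 * γ) := by positivity
    have hnonneg' : 0 ≤ 1 / (2 * γ) * ‖y - x‖ ^ 2 := by positivity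
    rw [real_inner_smul_left, henv, henv, abs_le]
    constructor <;> linarith
  · rw [smul_inv_smul₀ hγ.ne', sub_sub_cancel]
end

section
/- (Gribonval penalty construction.) Let σ > 0, c ∈ ℝ, and let m : ℝ → (0, ∞) be differentiable with (log m)′ differentiable. Define z(ŷ) = ŷ + σ² (log m)′(ŷ) and ψ(ŷ) = −(ŷ − z(ŷ))²/(2σ²) − log m(ŷ) + c. Then for every ŷ ∈ ℝ, ψ′(ŷ) = −(log m)′(ŷ) · z′(ŷ). In particular, if φ : ℝ → ℝ is differentiable and satisfies φ(z(ŷ)) = ψ(ŷ) for all ŷ, then φ′(z(ŷ)) · z′(ŷ) = −(log m)′(ŷ) · z′(ŷ) for all ŷ. -/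
/-- Gribonval penalty construction: with `z(ŷ) = ŷ + σ² (log m)′(ŷ)` and
`ψ(ŷ) = −(ŷ − z(ŷ))²/(2σ²) − log m(ŷ) + c`, one has `ψ′(ŷ) = −(log m)′(ŷ) · z′(ŷ)`
for all `ŷ`; hence if `φ` is differentiable and `φ(z(ŷ)) = ψ(ŷ)` for all `ŷ`, then
`φ′(z(ŷ)) · z′(ŷ) = −(log m)′(ŷ) · z′(ŷ)` for all `ŷ`. -/
theorem gribonval_penalty_construction (σ : ℝ) (hσ : 0 < σ) (c : ℝ)
    (m : ℝ → ℝ) (hmpos : ∀ t, 0 < m t) (hmdiff : Differentiable ℝ m)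
    (hm'diff : Differentiable ℝ (deriv fun t => Real.log (m t)))
    (z ψ : ℝ → ℝ)
    (hz : ∀ t, z t = t + σ ^ 2 * deriv (fun s => Real.log (m s)) t)
    (hψ : ∀ t, ψ t = -(t - z t) ^ 2 / (2 * σ ^ 2) - Real.log (m t) + c) :
    (∀ t : ℝ, deriv ψ t = -deriv (fun s => Real.log (m s)) t * deriv z t) ∧
      ∀ φ : ℝ → ℝ, Differentiable ℝ φ → (∀ t, φ (z t) = ψ t) →
        ∀ t : ℝ, deriv φ (z t) * deriv z t
          = -deriv (fun s => Real.log (m s)) t * deriv z t := by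
  have hlog : Differentiable ℝ fun s => Real.log (m s) :=
    hmdiff.log fun t => (hmpos t).ne'
  have hzdiff : Differentiable ℝ z := by
    rw [funext hz]
    exact differentiable_id.add (hm'diff.const_mul _)
  have hψ' (t : ℝ) :
      HasDerivAt ψ (-deriv (fun s => Real.log (m s)) t * deriv z t) t := by
    rw [funext hψ]
    have hsq := (((hasDerivAt_id' t).sub (hzdiff t).hasDerivAt).pow 2).neg.div_const (2 * σ ^ 2)
    refine ((hsq.sub (hlog t).hasDerivAt).add_const c).congr_deriv ?_
    have hsub : t - z t = -(σ ^ 2 * deriv (fun s => Real.log (m s)) t) := by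
      rw [hz t]; ring
    simp only [Pi.sub_apply, hsub]
    field_simp
    push_cast
    ring
  refine ⟨fun t => (hψ' t).deriv, fun φ hφ hφz t => ?_⟩
  have hcomp : φ ∘ z = ψ := funext hφz
  rw [← deriv_comp t (hφ _) (hzdiff t), hcomp, (hψ' t).deriv]
end

section
/- Let σ_e, σ_β > 0 and define F_{σ_β}(y) = exp(√2 y / σ_β) Φ(−y/σ_e − √2 σ_e/σ_β), where Φ is the standard normal cumulative distribution function. Then for every y ∈ ℝ, ∫_ℝ φ_{σ_e}(y − β) · (1/(√2 σ_β)) exp(−√2 |β| / σ_β) dβ = (1/(√2 σ_β)) exp(σ_e²/σ_β²) (F_{σ_β}(y) + F_{σ_β}(−y)). -/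
open MeasureTheory

/-- The standard normal cumulative distribution function. -/
noncomputable def stdNormalCdf (x : ℝ) : ℝ :=
  ∫ t in Set.Iic x, gaussPdf 1 t

lemma gaussPdf_neg (σ t : ℝ) : gaussPdf σ (-t) = gaussPdf σ t := by
  simp [gaussPdf]

lemma integrable_gaussPdf {σ : ℝ} (hσ : σ ≠ 0) : Integrable (gaussPdf σ) := by
  have hb : 0 < (2 * σ ^ 2)⁻¹ := by positivity
  refine ((integrable_exp_neg_mul_sq hb).const_mul
    (Real.sqrt (2 * Real.pi * σ ^ 2))⁻¹).congr (Filter.Eventually.of_forall fun t => ?_)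
  simp only [gaussPdf]
  congr 2
  field_simp

lemma stdNormalCdf_eq_integral_Ioi (x : ℝ) :
    stdNormalCdf x = ∫ u in Set.Ioi 0, gaussPdf 1 (x - u) := by
  have h := (Measure.measurePreserving_sub_left volume x).setIntegral_preimage_emb
    (MeasurableEquiv.subLeft x).measurableEmbedding (gaussPdf 1) (Set.Iic x)
  rw [Set.preimage_const_sub_Iic, sub_self, integral_Ici_eq_integral_Ioi] at h
  exact h.symm

/-- Completing the square: tilting a Gaussian density exponentially translates and rescales it. -/
lemma gaussPdf_mul_exp_neg {σ : ℝ} (hσ : 0 < σ) (a y β : ℝ) :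
    gaussPdf σ (y - β) * Real.exp (-(a * β)) =
      Real.exp (a ^ 2 * σ ^ 2 / 2 - a * y) * σ⁻¹ *
        gaussPdf 1 (y / σ - a * σ - σ⁻¹ * β) := by
  have hsqrt : Real.sqrt (2 * Real.pi * σ ^ 2) = Real.sqrt (2 * Real.pi) * σ := by
    rw [Real.sqrt_mul (by positivity), Real.sqrt_sq hσ.le]
  have hexp : Real.exp (-((y - β) ^ 2) / (2 * σ ^ 2)) * Real.exp (-(a * β)) =
      Real.exp (a ^ 2 * σ ^ 2 / 2 - a * y) *
        Real.exp (-((y / σ - a * σ - σ⁻¹ * β) ^ 2) / (2 * 1 ^ 2)) := by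
    rw [← Real.exp_add, ← Real.exp_add]
    congr 1
    field_simp
    ring
  simp only [gaussPdf]
  rw [mul_assoc, hexp, hsqrt, mul_inv, one_pow, mul_one, mul_one]
  ring

lemma integral_Ioi_gaussPdf_mul_exp_neg {σ : ℝ} (hσ : 0 < σ) (a y : ℝ) :
    ∫ β in Set.Ioi 0, gaussPdf σ (y - β) * Real.exp (-(a * β)) =
      Real.exp (a ^ 2 * σ ^ 2 / 2 - a * y) * stdNormalCdf (y / σ - a * σ) := by
  simp_rw [gaussPdf_mul_exp_neg hσ a y]
  rw [integral_const_mul,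
    integral_comp_mul_left_Ioi (fun u => gaussPdf 1 (y / σ - a * σ - u)) 0 (inv_pos.2 hσ),
    mul_zero, ← stdNormalCdf_eq_integral_Ioi, inv_inv, smul_eq_mul]
  field_simp

lemma integral_gaussPdf_mul_exp_neg_abs {σ a : ℝ} (hσ : 0 < σ) (ha : 0 ≤ a) (y : ℝ) :
    ∫ β, gaussPdf σ (y - β) * Real.exp (-(a * |β|)) =
      Real.exp (a ^ 2 * σ ^ 2 / 2) *
        (Real.exp (a * y) * stdNormalCdf (-y / σ - a * σ) +
          Real.exp (-(a * y)) * stdNormalCdf (y / σ - a * σ)) := by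
  have hint : Integrable fun β => gaussPdf σ (y - β) * Real.exp (-(a * |β|)) := by
    refine ((integrable_gaussPdf hσ.ne').comp_sub_left y).mul_bdd (c := 1)
      (by fun_prop) (Filter.Eventually.of_forall fun β => ?_)
    rw [Real.norm_eq_abs, Real.abs_exp, Real.exp_le_one_iff]
    exact neg_nonpos.2 (by positivity)
  have hpos (z : ℝ) : ∫ β in Set.Ioi 0, gaussPdf σ (z - β) * Real.exp (-(a * |β|)) =
      Real.exp (a ^ 2 * σ ^ 2 / 2 - a * z) * stdNormalCdf (z / σ - a * σ) := by
    rw [← integral_Ioi_gaussPdf_mul_exp_neg hσ]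
    refine setIntegral_congr_fun measurableSet_Ioi fun β hβ => ?_
    simp only [abs_of_pos (Set.mem_Ioi.1 hβ)]
  have hneg : ∫ β in Set.Iic 0, gaussPdf σ (y - β) * Real.exp (-(a * |β|)) =
      ∫ β in Set.Ioi 0, gaussPdf σ (-y - β) * Real.exp (-(a * |β|)) := by
    have h := integral_comp_neg_Ioi 0 fun β => gaussPdf σ (y - β) * Real.exp (-(a * |β|))
    rw [neg_zero] at h
    rw [← h]
    congr 1 with β
    rw [abs_neg, ← gaussPdf_neg σ (-y - β)]
    ring_nf
  rw [← intervalIntegral.integral_Iic_add_Ioi (b := 0) hint.integrableOn hint.integrableOn, hneg,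
    hpos, hpos, sub_eq_add_neg _ (a * -y), sub_eq_add_neg _ (a * y), Real.exp_add, Real.exp_add,
    mul_neg, neg_neg]
  ring

/-- Marginal density of `y` in the normal means model under a Laplace prior:
with `F_{σ_β}(y) = exp(√2 y/σ_β) Φ(−y/σ_e − √2 σ_e/σ_β)`, one has
`∫ φ_{σ_e}(y − β) (1/(√2 σ_β)) exp(−√2|β|/σ_β) dβ
  = (1/(√2 σ_β)) exp(σ_e²/σ_β²) (F_{σ_β}(y) + F_{σ_β}(−y))`. -/
theorem laplace_marginal (σe σβ : ℝ) (hσe : 0 < σe) (hσβ : 0 < σβ)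
    (F : ℝ → ℝ)
    (hF : ∀ y, F y = Real.exp (Real.sqrt 2 * y / σβ)
        * stdNormalCdf (-(y / σe) - Real.sqrt 2 * σe / σβ)) :
    ∀ y : ℝ,
      (∫ β : ℝ, gaussPdf σe (y - β)
          * ((Real.sqrt 2 * σβ)⁻¹ * Real.exp (-(Real.sqrt 2 * |β|) / σβ)))
        = (Real.sqrt 2 * σβ)⁻¹ * Real.exp (σe ^ 2 / σβ ^ 2) * (F y + F (-y)) := by
  intro y
  have ha : 0 ≤ Real.sqrt 2 / σβ := by positivity
  have hvar : (Real.sqrt 2 / σβ) ^ 2 * σe ^ 2 / 2 = σe ^ 2 / σβ ^ 2 := by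
    rw [div_pow, Real.sq_sqrt zero_le_two]
    field_simp
  calc
    _ = ∫ β, (Real.sqrt 2 * σβ)⁻¹ *
          (gaussPdf σe (y - β) * Real.exp (-(Real.sqrt 2 / σβ * |β|))) := by
      congr 1 with β
      rw [show -(Real.sqrt 2 * |β|) / σβ = -(Real.sqrt 2 / σβ * |β|) by ring]
      ring
    _ = _ := by
      rw [integral_const_mul, integral_gaussPdf_mul_exp_neg_abs hσe ha, hvar, hF, hF]
      ring_nf
end
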